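/- Let W = (W(t))_{t∈[0,1]} be a standard Brownian motion and S(W) = sup_{0≤t≤1} W(t). There exists a constant c₂ > 0 such that for every n ∈ ℕ and every choice of points t_1, ..., t_n ∈ (0,1], the algorithm A_n^non(W) = max_{k=1,...,n} W(t_k) satisfies E(|S(W) − A_n^non(W)|) ≥ c₂ · n^{−1/2}. -/

import Mathlib

open MeasureTheory ProbabilityTheory Filter

noncomputable section

/-- A standard Brownian motion on `[0,1]`: a centered Gaussian process with continuous
paths, `W 0 = 0`, and covariance `E(W s · W t) = min s t`. -/
def IsBrownianMotion {Ω : Type*} [MeasurableSpace Ω] (P : Measure Ω)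
    (W : ℝ → Ω → ℝ) : Prop :=
  (∀ t : ℝ, Measurable (W t)) ∧
  (∀ ω, W 0 ω = 0) ∧
  (∀ ω, ContinuousOn (fun t => W t ω) (Set.Icc 0 1)) ∧
  (∀ (n : ℕ) (c t : Fin n → ℝ), (∀ i, t i ∈ Set.Icc (0 : ℝ) 1) →
    ∃ v : NNReal, Measure.map (fun ω => ∑ i, c i * W (t i) ω) P = gaussianReal 0 v) ∧
  (∀ s t : ℝ, s ∈ Set.Icc (0 : ℝ) 1 → t ∈ Set.Icc (0 : ℝ) 1 →
    ∫ ω, W s ω * W t ω ∂P = min s t)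

/-- The supremum `S(W) = sup_{0 ≤ t ≤ 1} W t ω` of a path. -/
def supBM {Ω : Type*} (W : ℝ → Ω → ℝ) (ω : Ω) : ℝ :=
  sSup {x : ℝ | ∃ t ∈ Set.Icc (0 : ℝ) 1, x = W t ω}

/-- `X` is a centered Gaussian process with the covariance of Brownian motion on `[0, T]`. -/
structure IsGaussianBrownianOn {Ω : Type*} [MeasurableSpace Ω] (X : ℝ → Ω → ℝ) (T : ℝ)
    (P : Measure Ω) : Prop where
  isGaussianProcess : IsGaussianProcess X P
  measurable : ∀ t, Measurable (X t)
  integral_eq_zero : ∀ t, ∫ ω, X t ω ∂P = 0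
  covariance_eq : ∀ s ∈ Set.Icc 0 T, ∀ t ∈ Set.Icc 0 T, cov[X s, X t; P] = min s t

section GaussianBrownian

variable {Ω : Type*} [MeasurableSpace Ω] {P : Measure Ω}

lemma ProbabilityTheory.IsGaussianProcess.sub_comp {S T : Type*} {X : T → Ω → ℝ}
    (hX : IsGaussianProcess X P) (a b : S → T) :
    IsGaussianProcess (fun s ω => X (a s) ω - X (b s) ω) P := by
  classical
  exact hX.of_isGaussianProcess fun s => ⟨{a s, b s},
    { toFun x := x ⟨a s, by simp⟩ - x ⟨b s, by simp⟩
      map_add' x y := by simp; ring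
      map_smul' c x := by simp; ring }, fun ω => by simp⟩

lemma ProbabilityTheory.IsGaussianProcess.indepFun_sub_comp {S S' T : Type*} {X : T → Ω → ℝ}
    (hX : IsGaussianProcess X P) (a b : S → T) (c d : S' → T)
    (h : ∀ s s', cov[fun ω => X (a s) ω - X (b s) ω, fun ω => X (c s') ω - X (d s') ω; P] = 0) :
    IndepFun (fun ω s => X (a s) ω - X (b s) ω) (fun ω s => X (c s) ω - X (d s) ω) P := by
  refine IsGaussianProcess.indepFun_of_covariance_eq_zero
    (X := fun s ω => X (a s) ω - X (b s) ω) (Y := fun s ω => X (c s) ω - X (d s) ω) ?_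
    (fun s => (hX.aemeasurable _).sub (hX.aemeasurable _))
    (fun s => (hX.aemeasurable _).sub (hX.aemeasurable _)) h
  convert hX.sub_comp (Sum.elim a c) (Sum.elim b d) using 1
  ext s ω
  cases s <;> rfl

/-- The Lévy maximal inequality. -/
lemma levy_maximal_inequality [IsProbabilityMeasure P] {ι : Type*} [LinearOrder ι]
    {Y : ι → Ω → ℝ} {Z : Ω → ℝ} {F : Finset ι} (hY : ∀ v, Measurable (Y v)) (hZ : Measurable Z)
    (hind : ∀ v ∈ F, IndepFun (fun ω => Z ω - Y v ω)
      (fun ω (r : {r // r ∈ F ∧ r ≤ v}) => Y r ω) P)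
    (hsym : ∀ v ∈ F, 1 / 2 ≤ P.real {ω | 0 ≤ Z ω - Y v ω}) (x : ℝ) :
    P.real {ω | ∃ v ∈ F, x ≤ Y v ω} ≤ 2 * P.real {ω | x ≤ Z ω} := by
  set A : ι → Set Ω := fun v => {ω | x ≤ Y v ω ∧ ∀ r ∈ F, r < v → Y r ω < x} with hA
  set B : ι → Set Ω := fun v => {ω | 0 ≤ Z ω - Y v ω} with hB
  have hAm : ∀ v, MeasurableSet (A v) := fun v => by
    have : A v = {ω | x ≤ Y v ω} ∩ ⋂ r ∈ F, ⋂ _ : r < v, {ω | Y r ω < x} := by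
      ext; simp [hA]
    rw [this]
    exact (measurableSet_le measurable_const (hY v)).inter <|
      Finset.measurableSet_biInter _ fun r _ => MeasurableSet.iInter fun _ =>
        measurableSet_lt (hY r) measurable_const
  have hBm : ∀ v, MeasurableSet (B v) := fun v =>
    measurableSet_le measurable_const (hZ.sub (hY v))
  have hunion : {ω | ∃ v ∈ F, x ≤ Y v ω} = ⋃ v ∈ F, A v := by
    ext ω
    simp only [Set.mem_ofPred_eq, Set.mem_iUnion, exists_prop, hA]
    constructor
    · rintro ⟨v, hv, hx⟩
      obtain ⟨w, hw, hmin⟩ := (F.filter fun v => x ≤ Y v ω).exists_min_image id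
        ⟨v, by simp [hv, hx]⟩
      simp only [Finset.mem_filter, id_eq, and_imp] at hw hmin
      refine ⟨w, hw.1, hw.2, fun r hr hrw => ?_⟩
      by_contra! hcon
      exact absurd (hmin r hr hcon) (not_le.2 hrw)
    · rintro ⟨v, hv, hx, -⟩
      exact ⟨v, hv, hx⟩
  have hdisj : (F : Set ι).PairwiseDisjoint A := by
    intro v hv w hw hvw
    refine Set.disjoint_left.2 fun ω h1 h2 => ?_
    rcases lt_or_gt_of_ne hvw with h | h
    · exact absurd h1.1 (not_le.2 (h2.2 v hv h))
    · exact absurd h2.1 (not_le.2 (h1.2 w hw h))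
  have hprod : ∀ v ∈ F, P.real (A v) ≤ 2 * P.real (A v ∩ B v) := by
    intro v hv
    have hBA : P (B v ∩ A v) = P (B v) * P (A v) := by
      have := (hind v hv).measure_inter_preimage_eq_mul (Set.Ici 0)
        {y | x ≤ y ⟨v, hv, le_rfl⟩ ∧ ∀ r : {r // r ∈ F ∧ r ≤ v}, r.1 < v → y r < x}
        measurableSet_Ici ?_
      · have hpre : A v = (fun ω (r : {r // r ∈ F ∧ r ≤ v}) => Y r ω) ⁻¹'
            {y | x ≤ y ⟨v, hv, le_rfl⟩ ∧ ∀ r : {r // r ∈ F ∧ r ≤ v}, r.1 < v → y r < x} := by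
          ext ω; simp [hA]; grind
        rw [hpre]
        exact this
      · have hfin : Finite {r // r ∈ F ∧ r ≤ v} :=
          Finite.of_injective (fun r => (⟨r.1, r.2.1⟩ : F)) fun r s h => by
            simpa [Subtype.ext_iff] using h
        have : {y : {r // r ∈ F ∧ r ≤ v} → ℝ | x ≤ y ⟨v, hv, le_rfl⟩ ∧ ∀ r, r.1 < v → y r < x}
            = {y | x ≤ y ⟨v, hv, le_rfl⟩} ∩
              ⋂ r : {r // r ∈ F ∧ r ≤ v}, ⋂ _ : r.1 < v, {y | y r < x} := by ext; simp
        rw [this]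
        exact (measurableSet_le measurable_const (measurable_pi_apply _)).inter <|
          MeasurableSet.iInter fun r => MeasurableSet.iInter fun _ =>
          measurableSet_lt (measurable_pi_apply _) measurable_const
    rw [Set.inter_comm, measureReal_def P (B v ∩ A v), hBA, ENNReal.toReal_mul]
    have := hsym v hv
    simp only [← measureReal_def]
    nlinarith [measureReal_nonneg (μ := P) (s := A v)]
  rw [hunion, measureReal_biUnion_finset hdisj fun v _ => hAm v]
  calc ∑ v ∈ F, P.real (A v) ≤ ∑ v ∈ F, 2 * P.real (A v ∩ B v) := Finset.sum_le_sum hprod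
    _ = 2 * P.real (⋃ v ∈ F, A v ∩ B v) := by
      rw [← Finset.mul_sum, measureReal_biUnion_finset
        (hdisj.mono_on fun v _ => Set.inter_subset_left) fun v _ => (hAm v).inter (hBm v)]
    _ ≤ 2 * P.real {ω | x ≤ Z ω} := by
      gcongr
      · simp
      · refine Set.iUnion₂_subset fun v _ ω h => ?_
        have h1 := h.1.1
        have h2 := h.2
        simp only [hB, Set.mem_ofPred_eq] at h2 ⊢
        linarith

lemma gaussianReal_real_Iic_neg (v : NNReal) (x : ℝ) :
    (gaussianReal 0 v).real (Set.Iic (-x)) = (gaussianReal 0 v).real (Set.Ici x) := by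
  have h := gaussianReal_map_neg (μ := 0) (v := v)
  rw [neg_zero] at h
  conv_lhs => rw [← h]
  rw [map_measureReal_apply (by fun_prop) measurableSet_Iic]
  congr 1
  ext; simp

lemma half_le_gaussianReal_real_Ici_zero (v : NNReal) :
    1 / 2 ≤ (gaussianReal 0 v).real (Set.Ici 0) := by
  have h := gaussianReal_real_Iic_neg v 0
  have h2 := measureReal_union_le (μ := gaussianReal 0 v) (Set.Iic 0) (Set.Ici 0)
  rw [Set.Iic_union_Ici, probReal_univ] at h2
  rw [neg_zero] at h
  linarith

lemma gaussianReal_eq_map_sqrt (v : NNReal) :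
    gaussianReal 0 v = (gaussianReal 0 1).map (√(v : ℝ) * ·) := by
  rw [gaussianReal_map_const_mul]
  congr 1
  · simp
  · ext; simp

lemma mul_le_gaussianReal_real_Ioo {v : NNReal} (hv : v ≤ 1) {x : ℝ} (hx0 : 0 ≤ x) (hx1 : x ≤ 1) :
    gaussianPDFReal 0 1 1 * x ≤ (gaussianReal 0 v).real (Set.Ioo (-x) x) := by
  have h1 : gaussianPDFReal 0 1 1 * x ≤ (gaussianReal 0 1).real (Set.Ioo 0 x) := by
    rw [measureReal_def, gaussianReal_apply_eq_integral _ one_ne_zero,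
      ENNReal.toReal_ofReal (setIntegral_nonneg measurableSet_Ioo
        fun _ _ => gaussianPDFReal_nonneg _ _ _)]
    have := setIntegral_mono_on (μ := volume) (s := Set.Ioo 0 x)
      (f := fun _ => gaussianPDFReal 0 1 1) (g := gaussianPDFReal 0 1)
      (integrableOn_const (by simp)) (integrable_gaussianPDFReal 0 1).integrableOn
      measurableSet_Ioo (fun y hy => by
        simp only [gaussianPDFReal]
        have : y ≤ 1 := hy.2.le.trans hx1
        have : 0 < y := hy.1
        gcongr)
    simpa [hx0, mul_comm] using this
  rcases hx0.eq_or_lt with rfl | hx0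
  · simp
  refine h1.trans ?_
  rw [gaussianReal_eq_map_sqrt v, map_measureReal_apply (by fun_prop) measurableSet_Ioo]
  refine measureReal_mono fun y hy => ?_
  have hs : √(v : ℝ) ≤ 1 := Real.sqrt_le_one.2 (by exact_mod_cast hv)
  have hs0 := Real.sqrt_nonneg (v : ℝ)
  simp only [Set.mem_preimage, Set.mem_Ioo] at hy ⊢
  constructor
  · nlinarith
  · nlinarith

lemma gaussianReal_real_Iic_pos {v : NNReal} (hv : v ≠ 0) (x : ℝ) :
    0 < (gaussianReal 0 v).real (Set.Iic x) := by
  rw [measureReal_def, ENNReal.toReal_pos_iff]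
  refine ⟨pos_iff_ne_zero.2 fun h => ?_, measure_lt_top _ _⟩
  simpa using gaussianReal_absolutelyContinuous' 0 hv h

namespace IsGaussianBrownianOn

variable {X : ℝ → Ω → ℝ} {T : ℝ}

lemma memLp_two (hX : IsGaussianBrownianOn X T P) (t : ℝ) : MemLp (X t) 2 P :=
  (hX.isGaussianProcess.hasGaussianLaw_eval t).memLp_two

lemma memLp_two_sub (hX : IsGaussianBrownianOn X T P) (s t : ℝ) :
    MemLp (fun ω => X t ω - X s ω) 2 P :=
  (hX.memLp_two t).sub (hX.memLp_two s)

lemma measurable_sub (hX : IsGaussianBrownianOn X T P) (s t : ℝ) :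
    Measurable fun ω => X t ω - X s ω :=
  (hX.measurable t).sub (hX.measurable s)

variable [IsProbabilityMeasure P]

lemma covariance_sub_sub (hX : IsGaussianBrownianOn X T P) {a b c d : ℝ}
    (ha : a ∈ Set.Icc 0 T) (hb : b ∈ Set.Icc 0 T) (hc : c ∈ Set.Icc 0 T) (hd : d ∈ Set.Icc 0 T) :
    cov[fun ω => X a ω - X b ω, fun ω => X c ω - X d ω; P]
      = min a c - min a d - (min b c - min b d) := by
  rw [covariance_fun_sub_left (hX.memLp_two a) (hX.memLp_two b)
      (hX.memLp_two_sub d c),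
    covariance_fun_sub_right (hX.memLp_two a) (hX.memLp_two c) (hX.memLp_two d),
    covariance_fun_sub_right (hX.memLp_two b) (hX.memLp_two c) (hX.memLp_two d),
    hX.covariance_eq a ha c hc, hX.covariance_eq a ha d hd, hX.covariance_eq b hb c hc,
    hX.covariance_eq b hb d hd]

lemma map_sub (hX : IsGaussianBrownianOn X T P) {s t : ℝ} (hs : 0 ≤ s) (hst : s ≤ t) (ht : t ≤ T) :
    P.map (fun ω => X t ω - X s ω) = gaussianReal 0 (t - s).toNNReal := by
  have hs' : s ∈ Set.Icc 0 T := ⟨hs, hst.trans ht⟩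
  have ht' : t ∈ Set.Icc 0 T := ⟨hs.trans hst, ht⟩
  rw [(hX.isGaussianProcess.hasGaussianLaw_fun_sub (s := t) (t := s)).map_eq_gaussianReal,
    integral_sub ((hX.memLp_two t).integrable (by norm_num))
      ((hX.memLp_two s).integrable (by norm_num)), hX.integral_eq_zero, hX.integral_eq_zero,
    ← covariance_self (hX.measurable_sub s t).aemeasurable,
    hX.covariance_sub_sub ht' hs' ht' hs', min_self, min_self, min_eq_right hst, min_eq_left hst]
  simp

lemma indepFun_increments (hX : IsGaussianBrownianOn X T P) {S S' : Type*} (a b : S → ℝ)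
    (c d : S' → ℝ) (ha : ∀ s, a s ∈ Set.Icc 0 T) (hb : ∀ s, b s ∈ Set.Icc 0 T)
    (hc : ∀ s, c s ∈ Set.Icc 0 T) (hd : ∀ s, d s ∈ Set.Icc 0 T) {m : ℝ}
    (ham : ∀ s, a s ≤ m) (hbm : ∀ s, b s ≤ m) (hcm : ∀ s, m ≤ c s) (hdm : ∀ s, m ≤ d s) :
    IndepFun (fun ω s => X (a s) ω - X (b s) ω) (fun ω s => X (c s) ω - X (d s) ω) P := by
  refine hX.isGaussianProcess.indepFun_sub_comp a b c d fun s s' => ?_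
  rw [hX.covariance_sub_sub (ha s) (hb s) (hc s') (hd s'), min_eq_left ((ham s).trans (hcm s')),
    min_eq_left ((ham s).trans (hdm s')), min_eq_left ((hbm s).trans (hcm s')),
    min_eq_left ((hbm s).trans (hdm s'))]
  ring

lemma measureReal_exists_le (hX : IsGaussianBrownianOn X T P) {δ : ℝ} (hδ : 0 ≤ δ)
    {F : Finset ℝ} (hF : ∀ s ∈ F, s ∈ Set.Icc δ T) (x : ℝ) :
    P.real {ω | ∃ s ∈ F, x ≤ X s ω - X δ ω} ≤ 2 * P.real {ω | x ≤ X T ω - X δ ω} := by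
  refine levy_maximal_inequality (Y := fun v ω => X v ω - X δ ω)
    (fun v => hX.measurable_sub δ v) (hX.measurable_sub δ T) (fun v hv => ?_) (fun v hv => ?_) x
  · have h0 := hF v hv
    have := (hX.indepFun_increments (S := {r // r ∈ F ∧ r ≤ v}) (S' := Unit) (m := v)
      (fun r => r) (fun _ => δ) (fun _ => T) (fun _ => v)
      (fun r => ⟨hδ.trans (hF r r.2.1).1, (hF r r.2.1).2⟩)
      (fun _ => ⟨hδ, h0.1.trans h0.2⟩) (fun _ => ⟨hδ.trans (h0.1.trans h0.2), le_rfl⟩)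
      (fun _ => ⟨hδ.trans h0.1, h0.2⟩) (fun r => r.2.2) (fun _ => h0.1) (fun _ => h0.2)
      (fun _ => le_rfl)).symm
    have := this.comp (φ := fun y : Unit → ℝ => y ()) (ψ := id)
      (measurable_pi_apply (X := fun _ : Unit => ℝ) ()) measurable_id
    convert this using 1
    · ext ω; simp
    · rfl
  · have h0 := hF v hv
    have hset : {ω | 0 ≤ X T ω - X δ ω - (X v ω - X δ ω)}
        = (fun ω => X T ω - X v ω) ⁻¹' Set.Ici 0 := by
      ext; simp
    rw [hset, ← map_measureReal_apply (hX.measurable_sub v T) measurableSet_Ici,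
      hX.map_sub (hδ.trans h0.1) h0.2 le_rfl]
    exact half_le_gaussianReal_real_Ici_zero _

lemma mul_le_measureReal_forall_sub_lt (hX : IsGaussianBrownianOn X T P) {δ x : ℝ}
    (hδ : 0 ≤ δ) (hδT : δ ≤ T) (hT : T ≤ 1) {F : Finset ℝ} (hF : ∀ s ∈ F, s ∈ Set.Icc δ T)
    (hx0 : 0 ≤ x) (hx1 : x ≤ 1) :
    gaussianPDFReal 0 1 1 * x ≤ P.real {ω | ∀ s ∈ F, X s ω - X δ ω < x} := by
  rcases hx0.eq_or_lt with rfl | hx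
  · simp
  set v := (T - δ).toNNReal with hv
  have hv1 : v ≤ 1 := by rw [hv, Real.toNNReal_le_one]; linarith
  have hmeas : MeasurableSet {ω | ∃ s ∈ F, x ≤ X s ω - X δ ω} := by
    have : {ω | ∃ s ∈ F, x ≤ X s ω - X δ ω} = ⋃ s ∈ F, {ω | x ≤ X s ω - X δ ω} := by ext; simp
    rw [this]
    exact Finset.measurableSet_biUnion _ fun s _ =>
      measurableSet_le measurable_const (hX.measurable_sub δ s)
  have hlevy := hX.measureReal_exists_le hδ hF x
  have hcompl : {ω | ∀ s ∈ F, X s ω - X δ ω < x} = {ω | ∃ s ∈ F, x ≤ X s ω - X δ ω}ᶜ := by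
    ext; simp
  have hlaw : P.real {ω | x ≤ X T ω - X δ ω} = (gaussianReal 0 v).real (Set.Ici x) := by
    rw [← hX.map_sub hδ hδT le_rfl,
      map_measureReal_apply (hX.measurable_sub δ T) measurableSet_Ici]
    rfl
  have huniv : (gaussianReal 0 v).real (Set.Ioo (-x) x)
      + ((gaussianReal 0 v).real (Set.Iic (-x)) + (gaussianReal 0 v).real (Set.Ici x)) ≤ 1 := by
    rw [← measureReal_union (Set.disjoint_left.2 fun y h h' => ?_) measurableSet_Ici,
      ← measureReal_union (Set.disjoint_left.2 fun y h h' => ?_)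
        (measurableSet_Iic.union measurableSet_Ici)]
    · exact measureReal_le_one
    · exact h'.elim (fun h' => absurd h.1 (not_lt.2 h')) fun h' => absurd h.2 (not_lt.2 h')
    · simp only [Set.mem_Iic, Set.mem_Ici] at h h'
      linarith
  rw [gaussianReal_real_Iic_neg] at huniv
  rw [hcompl, probReal_compl_eq_one_sub hmeas]
  rw [hlaw] at hlevy
  linarith [mul_le_gaussianReal_real_Ioo hv1 hx0 hx1]

lemma mul_sqrt_le_measureReal_forall_le (hX : IsGaussianBrownianOn X T P) (hX0 : ∀ ω, X 0 ω = 0)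
    {δ : ℝ} (hδ : 0 < δ) (hδT : δ ≤ T) (hT : T ≤ 1) {F : Finset ℝ}
    (hF : ∀ s ∈ F, s ∈ Set.Icc δ T) :
    (gaussianReal 0 1).real (Set.Iic (-2)) * gaussianPDFReal 0 1 1 * √δ
      ≤ P.real {ω | ∀ s ∈ F, X s ω ≤ -√δ} := by
  have hind := (hX.indepFun_increments (S := Unit) (S' := F) (m := δ)
    (fun _ => δ) (fun _ => 0) (fun s => s) (fun _ => δ) (fun _ => ⟨hδ.le, hδT⟩)
    (fun _ => ⟨le_rfl, hδ.le.trans hδT⟩) (fun s => ⟨hδ.le.trans (hF s s.2).1, (hF s s.2).2⟩)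
    (fun _ => ⟨hδ.le, hδT⟩) (fun _ => le_rfl) (fun _ => hδ.le) (fun s => (hF s s.2).1)
    (fun _ => le_rfl)).measure_inter_preimage_eq_mul {y | y () ≤ -2 * √δ} {y | ∀ s, y s < √δ}
    (measurableSet_le (measurable_pi_apply _) measurable_const) (by
      have : {y : F → ℝ | ∀ s, y s < √δ} = ⋂ s, {y | y s < √δ} := by ext; simp
      rw [this]
      exact MeasurableSet.iInter fun s =>
        measurableSet_lt (measurable_pi_apply _) measurable_const)
  have h1 : P.real ((fun ω (_ : Unit) => X δ ω - X 0 ω) ⁻¹' {y | y () ≤ -2 * √δ})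
      = (gaussianReal 0 1).real (Set.Iic (-2)) := by
    have hset : (fun ω (_ : Unit) => X δ ω - X 0 ω) ⁻¹' {y | y () ≤ -2 * √δ}
        = (fun ω => X δ ω - X 0 ω) ⁻¹' Set.Iic (-2 * √δ) := rfl
    rw [hset, ← map_measureReal_apply (hX.measurable_sub 0 δ) measurableSet_Iic,
      hX.map_sub le_rfl hδ.le hδT, gaussianReal_eq_map_sqrt,
      map_measureReal_apply (by fun_prop) measurableSet_Iic]
    congr 1
    ext y
    have : 0 < √δ := Real.sqrt_pos.2 hδ
    simp only [sub_zero, Real.coe_toNNReal _ hδ.le, Set.mem_preimage, Set.mem_Iic]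
    rw [mul_comm, mul_le_mul_iff_left₀ this]
  have h2 : gaussianPDFReal 0 1 1 * √δ
      ≤ P.real ((fun ω (s : F) => X s ω - X δ ω) ⁻¹' {y | ∀ s, y s < √δ}) := by
    refine (hX.mul_le_measureReal_forall_sub_lt hδ.le hδT hT hF (Real.sqrt_nonneg δ)
      (Real.sqrt_le_one.2 (hδT.trans hT))).trans_eq ?_
    congr 1
    ext; simp
  calc _ = (gaussianReal 0 1).real (Set.Iic (-2)) * (gaussianPDFReal 0 1 1 * √δ) := by ring
    _ ≤ _ := mul_le_mul_of_nonneg_left h2 measureReal_nonneg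
    _ = P.real (_ ∩ _) := by
      rw [← h1, measureReal_def, measureReal_def, ← ENNReal.toReal_mul, ← hind, ← measureReal_def]
    _ ≤ _ := by
      refine measureReal_mono fun ω hω s hs => ?_
      have h3 := hω.1
      have h4 := hω.2 ⟨s, hs⟩
      simp only [Set.mem_preimage, Set.mem_ofPred_eq, hX0] at h3 h4
      linarith

lemma shift_right (hX : IsGaussianBrownianOn X T P) {m : ℝ} (hm : m ∈ Set.Icc 0 T) :
    IsGaussianBrownianOn (fun u ω => X (m + u) ω - X m ω) (T - m) P where
  isGaussianProcess := hX.isGaussianProcess.sub_comp _ _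
  measurable u := hX.measurable_sub m (m + u)
  integral_eq_zero u := by
    rw [integral_sub ((hX.memLp_two _).integrable (by norm_num))
      ((hX.memLp_two m).integrable (by norm_num)), hX.integral_eq_zero, hX.integral_eq_zero,
      sub_zero]
  covariance_eq s hs t ht := by
    have h := hm.1
    have hs0 := hs.1
    have ht0 := ht.1
    rw [hX.covariance_sub_sub ⟨by linarith, by linarith [hs.2]⟩ hm
      ⟨by linarith, by linarith [ht.2]⟩ hm, min_add_add_left,
      min_eq_right (a := m + s) (by linarith), min_eq_left (b := m + t) (by linarith), min_self]
    ring

lemma shift_left (hX : IsGaussianBrownianOn X T P) {m : ℝ} (hm : m ∈ Set.Icc 0 T) :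
    IsGaussianBrownianOn (fun u ω => X (m - u) ω - X m ω) m P where
  isGaussianProcess := hX.isGaussianProcess.sub_comp _ _
  measurable u := hX.measurable_sub m (m - u)
  integral_eq_zero u := by
    rw [integral_sub ((hX.memLp_two _).integrable (by norm_num))
      ((hX.memLp_two m).integrable (by norm_num)), hX.integral_eq_zero, hX.integral_eq_zero,
      sub_zero]
  covariance_eq s hs t ht := by
    have h := hm.2
    have hs0 := hs.1
    have ht0 := ht.1
    rw [hX.covariance_sub_sub ⟨by linarith [hs.2], by linarith⟩ hm
      ⟨by linarith [ht.2], by linarith⟩ hm, min_sub_sub_left, min_eq_left (by linarith),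
      min_eq_right (by linarith), min_self]
    linarith [min_add_max s t]

/-- A lower bound for the probability that `X m` exceeds `X` by at least `√δ` at all the points
of `F` at distance at least `δ` from `m`. -/
lemma mul_le_measureReal_forall_sub_le (hX : IsGaussianBrownianOn X 1 P) {m δ : ℝ}
    (hδ : 0 < δ) (hδm : δ ≤ m) (hmδ : m + δ ≤ 1) {F : Finset ℝ} (hF : ∀ s ∈ F, s ∈ Set.Icc 0 1) :
    ((gaussianReal 0 1).real (Set.Iic (-2)) * gaussianPDFReal 0 1 1) ^ 2 * δ
      ≤ P.real {ω | ∀ s ∈ F, δ ≤ |s - m| → X s ω - X m ω ≤ -√δ} := by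
  classical
  set c := (gaussianReal 0 1).real (Set.Iic (-2)) * gaussianPDFReal 0 1 1
  have hc : 0 ≤ c := mul_nonneg measureReal_nonneg (gaussianPDFReal_nonneg _ _ _)
  have hm : m ∈ Set.Icc 0 1 := ⟨by linarith, by linarith⟩
  set L : Finset ℝ := (F.filter (· ≤ m - δ)).image (m - ·) with hL
  set R : Finset ℝ := (F.filter (m + δ ≤ ·)).image (· - m) with hR
  have hLm : ∀ s ∈ L, s ∈ Set.Icc δ m := by
    intro s hs
    simp only [hL, Finset.mem_image, Finset.mem_filter] at hs
    obtain ⟨r, ⟨hr, h⟩, rfl⟩ := hs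
    exact ⟨by linarith, by linarith [(hF r hr).1]⟩
  have hRm : ∀ s ∈ R, s ∈ Set.Icc δ (1 - m) := by
    intro s hs
    simp only [hR, Finset.mem_image, Finset.mem_filter] at hs
    obtain ⟨r, ⟨hr, h⟩, rfl⟩ := hs
    exact ⟨by linarith, by linarith [(hF r hr).2]⟩
  have hPL := (hX.shift_left hm).mul_sqrt_le_measureReal_forall_le (by simp) hδ hδm hm.2 hLm
  have hPR := (hX.shift_right hm).mul_sqrt_le_measureReal_forall_le (by simp) hδ
    (by linarith) (by linarith) hRm
  have hmeas (G : Finset ℝ) : MeasurableSet {y : G → ℝ | ∀ s, y s ≤ -√δ} := by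
    have : {y : G → ℝ | ∀ s, y s ≤ -√δ} = ⋂ s, {y | y s ≤ -√δ} := by ext; simp
    rw [this]
    exact MeasurableSet.iInter fun s => measurableSet_le (measurable_pi_apply _) measurable_const
  have hind := (hX.indepFun_increments (S := L) (S' := R) (m := m)
    (fun s => m - s) (fun _ => m) (fun s => m + s) (fun _ => m)
    (fun s => ⟨by linarith [(hLm s s.2).2], by linarith [(hLm s s.2).1, hm.2]⟩) (fun _ => hm)
    (fun s => ⟨by linarith [(hRm s s.2).1, hm.1], by linarith [(hRm s s.2).2]⟩) (fun _ => hm)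
    (fun s => by linarith [(hLm s s.2).1]) (fun _ => le_rfl)
    (fun s => by linarith [(hRm s s.2).1]) (fun _ => le_rfl)).measure_inter_preimage_eq_mul
      {y | ∀ s, y s ≤ -√δ} {y | ∀ s, y s ≤ -√δ} (hmeas L) (hmeas R)
  have hLs : (fun ω (s : L) => X (m - s) ω - X m ω) ⁻¹' {y | ∀ s, y s ≤ -√δ}
      = {ω | ∀ s ∈ L, X (m - s) ω - X m ω ≤ -√δ} := by ext; simp
  have hRs : (fun ω (s : R) => X (m + s) ω - X m ω) ⁻¹' {y | ∀ s, y s ≤ -√δ}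
      = {ω | ∀ s ∈ R, X (m + s) ω - X m ω ≤ -√δ} := by ext; simp
  rw [hLs, hRs] at hind
  calc c ^ 2 * δ = (c * √δ) * (c * √δ) := by
        rw [mul_mul_mul_comm, Real.mul_self_sqrt hδ.le, sq]
    _ ≤ _ := mul_le_mul hPL hPR (by positivity) measureReal_nonneg
    _ = _ := by
      rw [measureReal_def, measureReal_def, ← ENNReal.toReal_mul, ← hind, ← measureReal_def]
    _ ≤ _ := by
      refine measureReal_mono fun ω hω s hs hsm => ?_
      rcases le_abs'.1 hsm with h | h
      · have := hω.1 (m - s) (Finset.mem_image_of_mem _ (by simp [hs]; linarith))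
        simpa using this
      · have := hω.2 (s - m) (Finset.mem_image_of_mem (· - m) (by simp [hs]; linarith))
        simpa using this

end IsGaussianBrownianOn

namespace IsBrownianMotion

variable {W : ℝ → Ω → ℝ}

lemma exists_map_sum_eq (hW : IsBrownianMotion P W) {ι : Type*} [Fintype ι] (c t : ι → ℝ)
    (ht : ∀ i, t i ∈ Set.Icc (0 : ℝ) 1) :
    ∃ v : NNReal, P.map (fun ω => ∑ i, c i * W (t i) ω) = gaussianReal 0 v := by
  obtain ⟨v, hv⟩ := hW.2.2.2.1 (Fintype.card ι) (c ∘ (Fintype.equivFin ι).symm)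
    (t ∘ (Fintype.equivFin ι).symm) fun i => ht _
  refine ⟨v, hv ▸ ?_⟩
  congr 1
  ext ω
  exact ((Fintype.equivFin ι).symm.sum_comp fun i => c i * W (t i) ω).symm

lemma exists_map_eq (hW : IsBrownianMotion P W) {t : ℝ} (ht : t ∈ Set.Icc (0 : ℝ) 1) :
    ∃ v : NNReal, P.map (W t) = gaussianReal 0 v := by
  simpa using hW.exists_map_sum_eq (fun _ : Unit => 1) (fun _ => t) fun _ => ht

lemma isGaussianProcess_comp (hW : IsBrownianMotion P W) {S : Type*} {φ : S → ℝ}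
    (hφ : ∀ s, φ s ∈ Set.Icc (0 : ℝ) 1) : IsGaussianProcess (fun s => W (φ s)) P where
  hasGaussianLaw I := by
    classical
    refine ⟨isGaussian_of_map_eq_gaussianReal fun L => ?_⟩
    obtain ⟨v, hv⟩ := hW.exists_map_sum_eq (fun i : I => L fun j => if i = j then 1 else 0)
      (fun i => φ i) fun i => hφ i
    refine ⟨0, v, ?_⟩
    have hm : Measurable fun ω => I.restrict fun s => W (φ s) ω :=
      measurable_pi_lambda _ fun i => hW.1 _
    rw [← hv, Measure.map_map L.measurable hm]
    congr 1
    ext ω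
    simpa [mul_comm] using L.toLinearMap.pi_apply_eq_sum_univ (I.restrict fun s => W (φ s) ω)

lemma bddAbove (hW : IsBrownianMotion P W) (ω : Ω) :
    BddAbove {x : ℝ | ∃ t ∈ Set.Icc (0 : ℝ) 1, x = W t ω} := by
  have := isCompact_Icc.bddAbove_image (hW.2.2.1 ω)
  refine this.mono ?_
  rintro _ ⟨t, ht, rfl⟩
  exact ⟨t, ht, rfl⟩

lemma le_supBM (hW : IsBrownianMotion P W) {t : ℝ} (ht : t ∈ Set.Icc (0 : ℝ) 1) (ω : Ω) :
    W t ω ≤ supBM W ω :=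
  le_csSup (hW.bddAbove ω) ⟨t, ht, rfl⟩

lemma supBM_nonneg (hW : IsBrownianMotion P W) (ω : Ω) : 0 ≤ supBM W ω := by
  simpa [hW.2.1 ω] using hW.le_supBM (t := 0) (by simp) ω

lemma exists_seq_lt_supBM_iff (hW : IsBrownianMotion P W) :
    ∃ q : ℕ → ℝ, (∀ j, q j ∈ Set.Icc (0 : ℝ) 1) ∧
      ∀ ω x, x < supBM W ω ↔ ∃ j, x < W (q j) ω := by
  refine ⟨fun j => TopologicalSpace.denseSeq (Set.Icc (0 : ℝ) 1) j, fun j => Subtype.prop _,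
    fun ω x => ⟨fun h => ?_, fun ⟨j, hj⟩ => hj.trans_le (hW.le_supBM (Subtype.prop _) ω)⟩⟩
  obtain ⟨_, ⟨t, ht, rfl⟩, hx⟩ := exists_lt_of_lt_csSup
    (s := {x : ℝ | ∃ t ∈ Set.Icc (0 : ℝ) 1, x = W t ω}) ⟨W 0 ω, 0, by simp, rfl⟩ h
  have hcont := continuousOn_iff_continuous_domRestrict.1 (hW.2.2.1 ω)
  exact (TopologicalSpace.denseRange_denseSeq (Set.Icc (0 : ℝ) 1)).exists_mem_open
    (isOpen_Ioi.preimage hcont) ⟨⟨t, ht⟩, hx⟩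

lemma measurable_supBM (hW : IsBrownianMotion P W) : Measurable (supBM W) := by
  obtain ⟨q, -, hq⟩ := hW.exists_seq_lt_supBM_iff
  refine measurable_of_Ioi fun x => ?_
  have : supBM W ⁻¹' Set.Ioi x = ⋃ j, {ω | x < W (q j) ω} := by ext ω; simp [hq]
  rw [this]
  exact MeasurableSet.iUnion fun j => measurableSet_lt measurable_const (hW.1 _)

variable [IsProbabilityMeasure P]

lemma isGaussianBrownianOn (hW : IsBrownianMotion P W) :
    IsGaussianBrownianOn (fun t => W (max 0 (min t 1))) 1 P := by
  have hφ (t : ℝ) : max 0 (min t 1) ∈ Set.Icc (0 : ℝ) 1 := by simp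
  have hG := hW.isGaussianProcess_comp hφ
  have hint (t : ℝ) : ∫ ω, W (max 0 (min t 1)) ω ∂P = 0 := by
    obtain ⟨v, hv⟩ := hW.exists_map_eq (hφ t)
    have := integral_map (μ := P) (hW.1 (max 0 (min t 1))).aemeasurable
      (f := id) aestronglyMeasurable_id
    simpa [hv, integral_id_gaussianReal] using this.symm
  refine ⟨hG, fun t => hW.1 _, hint, fun s hs t ht => ?_⟩
  rw [covariance_eq_sub (hG.hasGaussianLaw_eval s).memLp_two (hG.hasGaussianLaw_eval t).memLp_two,
    hint, hint, zero_mul, sub_zero]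
  simp only [Pi.mul_apply]
  rw [hW.2.2.2.2 _ _ (hφ s) (hφ t), min_eq_left hs.2, min_eq_left ht.2, max_eq_right hs.1,
    max_eq_right ht.1]

lemma measure_lt_supBM_le (hW : IsBrownianMotion P W) (x : ℝ) :
    P {ω | x < supBM W ω} ≤ 2 * P {ω | x ≤ |W 1 ω|} := by
  obtain ⟨q, hq1, hq⟩ := hW.exists_seq_lt_supBM_iff
  have hset : {ω | x < supBM W ω} = ⋃ n : ℕ, {ω | ∃ j < n, x < W (q j) ω} := by
    ext ω
    simp only [hq, Set.mem_ofPred_eq, Set.mem_iUnion]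
    exact ⟨fun ⟨j, hj⟩ => ⟨j + 1, j, j.lt_succ_self, hj⟩, fun ⟨_, j, _, hj⟩ => ⟨j, hj⟩⟩
  have hmono : Monotone fun n : ℕ => {ω | ∃ j < n, x < W (q j) ω} :=
    fun _ _ h _ ⟨j, hj, hx⟩ => ⟨j, hj.trans_le h, hx⟩
  rw [hset, hmono.measure_iUnion]
  refine iSup_le fun n => ?_
  have hmax := hW.isGaussianBrownianOn.measureReal_exists_le le_rfl
    (F := (Finset.range n).image q) (fun s hs => by
      obtain ⟨j, -, rfl⟩ := Finset.mem_image.1 hs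
      exact hq1 j) x
  have h2 : P {ω | ∃ j < n, x < W (q j) ω}
      ≤ P {ω | ∃ s ∈ (Finset.range n).image q,
        x ≤ W (max 0 (min s 1)) ω - W (max 0 (min 0 1)) ω} := by
    refine measure_mono fun ω ⟨j, hj, hx⟩ => ⟨q j, by simpa using ⟨j, hj, rfl⟩, ?_⟩
    rw [min_eq_left (hq1 j).2, max_eq_right (hq1 j).1]
    simpa [hW.2.1 ω] using hx.le
  refine h2.trans ?_
  have h3 : P {ω | x ≤ W (max 0 (min 1 1)) ω - W (max 0 (min 0 1)) ω} ≤ P {ω | x ≤ |W 1 ω|} := by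
    refine measure_mono fun ω hω => ?_
    simp only [Set.mem_ofPred_eq, min_self, zero_le_one, max_eq_right, min_eq_left, max_self,
      hW.2.1 ω, sub_zero] at hω ⊢
    exact hω.trans (le_abs_self _)
  refine le_trans ?_ (mul_le_mul_right h3 2)
  rw [measureReal_def, measureReal_def] at hmax
  rw [← ENNReal.toReal_le_toReal (measure_ne_top _ _)
    (ENNReal.mul_ne_top (by simp) (measure_ne_top _ _)), ENNReal.toReal_mul]
  simpa using hmax

lemma integrable_eval (hW : IsBrownianMotion P W) {t : ℝ} (ht : t ∈ Set.Icc (0 : ℝ) 1) :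
    Integrable (W t) P := by
  have := (hW.isGaussianBrownianOn.memLp_two t).integrable (by norm_num)
  simpa [min_eq_left ht.2, max_eq_right ht.1] using this

lemma integrable_supBM (hW : IsBrownianMotion P W) : Integrable (supBM W) P := by
  refine ⟨hW.measurable_supBM.aestronglyMeasurable, ?_⟩
  rw [hasFiniteIntegral_iff_ofReal (Eventually.of_forall hW.supBM_nonneg),
    lintegral_eq_lintegral_meas_lt P (Eventually.of_forall hW.supBM_nonneg)
      hW.measurable_supBM.aemeasurable]
  have h1 := (hW.integrable_eval (t := 1) (by simp)).abs
  have h2 := h1.2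
  rw [hasFiniteIntegral_iff_ofReal (Eventually.of_forall fun _ => abs_nonneg _),
    lintegral_eq_lintegral_meas_le P (Eventually.of_forall fun _ => abs_nonneg _)
      h1.aemeasurable] at h2
  refine lt_of_le_of_lt (lintegral_mono fun x => hW.measure_lt_supBM_le x) ?_
  rw [lintegral_const_mul' _ _ (by simp)]
  exact ENNReal.mul_lt_top (by simp) h2

lemma integrable_sSup {n : ℕ} (hn : 0 < n) (hW : IsBrownianMotion P W) {t : Fin n → ℝ}
    (ht : ∀ k, t k ∈ Set.Icc (0 : ℝ) 1) :
    Integrable (fun ω => sSup {x : ℝ | ∃ k : Fin n, x = W (t k) ω}) P := by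
  have : Nonempty (Fin n) := ⟨⟨0, hn⟩⟩
  have hset (ω : Ω) : {x : ℝ | ∃ k : Fin n, x = W (t k) ω} = Set.range fun k => W (t k) ω := by
    ext x; simp [eq_comm]
  simp only [hset, sSup_range]
  refine (integrable_finsetSum Finset.univ fun k _ => (hW.integrable_eval (ht k)).abs).mono'
    (Measurable.iSup fun k => hW.1 _).aestronglyMeasurable (Eventually.of_forall fun ω => ?_)
  obtain ⟨k, hk⟩ := exists_eq_ciSup_of_finite (f := fun k => W (t k) ω)
  rw [← hk, Real.norm_eq_abs]
  exact Finset.single_le_sum (f := fun k => |W (t k) ω|) (fun _ _ => abs_nonneg _)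
    (Finset.mem_univ k)

end IsBrownianMotion

/-- Among the `2 * n` cells of length `1 / (2 * n)`, at least `n` contain none of `n` given points
in their interior. -/
lemma le_card_filter_forall_le_abs_sub {n : ℕ} (hn : 0 < n) (t : Fin n → ℝ) :
    n ≤ ((Finset.range (2 * n)).filter fun i : ℕ =>
      ∀ k, 1 / (4 * n : ℝ) ≤ |t k - (2 * i + 1) * (1 / (4 * n))|).card := by
  classical
  have hn' : (0 : ℝ) < n := by exact_mod_cast hn
  have hbad : (Finset.range (2 * n)).filter (fun i : ℕ =>
      ¬ ∀ k, 1 / (4 * n : ℝ) ≤ |t k - (2 * i + 1) * (1 / (4 * n))|)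
      ⊆ Finset.univ.image fun k => ⌊t k * (2 * n)⌋₊ := by
    intro i hi
    simp only [Finset.mem_filter, not_forall, not_le] at hi
    obtain ⟨-, k, hk⟩ := hi
    refine Finset.mem_image.2 ⟨k, Finset.mem_univ _, ?_⟩
    have h := abs_lt.1 hk
    have h1 : (2 * i : ℝ) * (1 / (4 * n)) < t k := by linarith [h.1]
    have h2 : t k < (2 * i + 2 : ℝ) * (1 / (4 * n)) := by linarith [h.2]
    rw [mul_one_div, div_lt_iff₀ (by positivity)] at h1
    rw [mul_one_div, lt_div_iff₀ (by positivity)] at h2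
    have hi0 : (0 : ℝ) ≤ i := by positivity
    rw [Nat.floor_eq_iff (by linarith)]
    exact ⟨by linarith, by linarith⟩
  have h1 := (Finset.card_le_card hbad).trans Finset.card_image_le
  have h2 := Finset.card_filter_add_card_filter_not (s := Finset.range (2 * n)) fun i : ℕ =>
      ∀ k, 1 / (4 * n : ℝ) ≤ |t k - (2 * i + 1) * (1 / (4 * n))|
  simp only [Finset.card_univ, Fintype.card_fin, Finset.card_range] at h1 h2
  omega

lemma IsBrownianMotion.mul_le_integral_abs_supBM_sub [IsProbabilityMeasure P] {W : ℝ → Ω → ℝ}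
    (hW : IsBrownianMotion P W) {n : ℕ} (hn : 0 < n) {t : Fin n → ℝ}
    (ht : ∀ k, t k ∈ Set.Icc (0 : ℝ) 1) :
    √(1 / (4 * n : ℝ)) * (n * (((gaussianReal 0 1).real (Set.Iic (-2)) *
        gaussianPDFReal 0 1 1) ^ 2 * (1 / (4 * n : ℝ))))
      ≤ ∫ ω, |supBM W ω - sSup {x : ℝ | ∃ k : Fin n, x = W (t k) ω}| ∂P := by
  classical
  have hcard := le_card_filter_forall_le_abs_sub hn t
  have hn' : (0 : ℝ) < n := by exact_mod_cast hn
  set δ : ℝ := 1 / (4 * n) with hδ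
  set p : ℝ := ((gaussianReal 0 1).real (Set.Iic (-2)) * gaussianPDFReal 0 1 1) ^ 2 * δ with hp
  set m : ℕ → ℝ := fun i => (2 * i + 1) * δ with hm
  set G := (Finset.range (2 * n)).filter fun i : ℕ => ∀ k, δ ≤ |t k - m i| with hG
  have hδ0 : 0 < δ := by positivity
  have hsδ : 0 < √δ := Real.sqrt_pos.2 hδ0
  have hnδ : 4 * n * δ = 1 := by rw [hδ]; field_simp
  have hm1 {i : ℕ} (hi : i < 2 * n) : δ ≤ m i ∧ m i + δ ≤ 1 := by
    have : (i : ℝ) + 1 ≤ 2 * n := by exact_mod_cast hi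
    have hi0 : (0 : ℝ) ≤ i := by positivity
    simp only [hm]
    constructor <;> nlinarith
  have hm01 {i : ℕ} (hi : i < 2 * n) : m i ∈ Set.Icc 0 1 :=
    ⟨by linarith [(hm1 hi).1], by linarith [(hm1 hi).2]⟩
  set V : ℝ → Ω → ℝ := fun t => W (max 0 (min t 1)) with hV
  have hVW {s : ℝ} (hs : s ∈ Set.Icc (0 : ℝ) 1) : V s = W s := by
    simp only [hV, min_eq_left hs.2, max_eq_right hs.1]
  have hVB : IsGaussianBrownianOn V 1 P := hW.isGaussianBrownianOn
  set F : Finset ℝ := Finset.univ.image t ∪ (Finset.range (2 * n)).image m with hF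
  have hF01 : ∀ s ∈ F, s ∈ Set.Icc (0 : ℝ) 1 := by
    intro s hs
    simp only [hF, Finset.mem_union, Finset.mem_image, Finset.mem_univ, true_and,
      Finset.mem_range] at hs
    rcases hs with ⟨k, rfl⟩ | ⟨i, hi, rfl⟩
    · exact ht k
    · exact hm01 hi
  set E : ℕ → Set Ω := fun i => {ω | ∀ s ∈ F, δ ≤ |s - m i| → V s ω - V (m i) ω ≤ -√δ} with hE
  have hEp {i : ℕ} (hi : i ∈ G) : p ≤ P.real (E i) := by
    have := hm1 (Finset.mem_range.1 (Finset.mem_filter.1 hi).1)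
    exact hVB.mul_le_measureReal_forall_sub_le hδ0 this.1 this.2 hF01
  have hEm (i : ℕ) : MeasurableSet (E i) := by
    have : E i = ⋂ s ∈ F, ⋂ _ : δ ≤ |s - m i|, {ω | V s ω - V (m i) ω ≤ -√δ} := by ext; simp [hE]
    rw [this]
    exact Finset.measurableSet_biInter _ fun s _ => MeasurableSet.iInter fun _ =>
      measurableSet_le (hVB.measurable_sub (m i) s) measurable_const
  have hdist {i j : ℕ} (hij : i ≠ j) : δ ≤ |m i - m j| := by
    have h1 : (1 : ℝ) ≤ |(i : ℝ) - j| := by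
      have : (1 : ℤ) ≤ |(i : ℤ) - j| := Int.one_le_abs (sub_ne_zero.2 (by exact_mod_cast hij))
      exact_mod_cast this
    have h2 : m i - m j = 2 * δ * (i - j) := by simp only [hm]; ring
    rw [h2, abs_mul, abs_of_pos (by positivity)]
    nlinarith
  have hmF {i : ℕ} (hi : i ∈ G) : m i ∈ F :=
    Finset.mem_union_right _ (Finset.mem_image_of_mem _ (Finset.mem_filter.1 hi).1)
  have hdisj : (G : Set ℕ).PairwiseDisjoint E := by
    intro i hi j hj hij
    refine Set.disjoint_left.2 fun ω h1 h2 => ?_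
    have h3 := h1 (m j) (hmF hj) (hdist hij.symm)
    have h4 := h2 (m i) (hmF hi) (hdist hij)
    linarith
  have hsub : (⋃ i ∈ G, E i)
      ⊆ {ω | √δ ≤ |supBM W ω - sSup {x : ℝ | ∃ k : Fin n, x = W (t k) ω}|} := by
    refine Set.iUnion₂_subset fun i hi ω hω => ?_
    have hi' := Finset.mem_filter.1 hi
    have h1 : sSup {x : ℝ | ∃ k : Fin n, x = W (t k) ω} ≤ V (m i) ω - √δ := by
      refine csSup_le ⟨_, ⟨0, hn⟩, rfl⟩ ?_
      rintro _ ⟨k, rfl⟩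
      have := hω (t k) (Finset.mem_union_left _ (Finset.mem_image_of_mem t (Finset.mem_univ k)))
        (hi'.2 k)
      rw [hVW (ht k)] at this
      linarith
    have hmi := hm01 (Finset.mem_range.1 hi'.1)
    have h2 := hW.le_supBM hmi ω
    rw [hVW hmi] at h1
    exact (by linarith : √δ ≤ _).trans (le_abs_self _)
  calc √δ * (n * p) ≤ √δ * P.real (⋃ i ∈ G, E i) := by
        gcongr
        rw [measureReal_biUnion_finset hdisj fun i _ => hEm i]
        calc n * p ≤ G.card * p := by gcongr
          _ = ∑ _i ∈ G, p := by simp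
          _ ≤ _ := Finset.sum_le_sum fun i hi => hEp hi
    _ ≤ √δ * P.real {ω | √δ ≤ |supBM W ω - sSup {x : ℝ | ∃ k : Fin n, x = W (t k) ω}|} := by
        gcongr
        exact measure_ne_top _ _
    _ ≤ _ := mul_meas_ge_le_integral_of_nonneg (Eventually.of_forall fun _ => abs_nonneg (α := ℝ) _)
        (hW.integrable_supBM.sub (hW.integrable_sSup hn ht)).abs _

end GaussianBrownian

/-- Lower error bound for arbitrary non-adaptive (fixed-point) maximum algorithms
`A_n^non(W) = max_{k=1,…,n} W(t_k)` with `t₁, …, t_n ∈ (0,1]`: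
`E(|S(W) − A_n^non(W)|) ≥ c₂ · n^{−1/2}`. -/
theorem stmt3 {Ω : Type*} [MeasurableSpace Ω] (P : Measure Ω) [IsProbabilityMeasure P]
    (W : ℝ → Ω → ℝ) (hW : IsBrownianMotion P W) :
    ∃ c₂ > (0 : ℝ), ∀ n : ℕ, 0 < n → ∀ t : Fin n → ℝ, (∀ k, t k ∈ Set.Ioc (0 : ℝ) 1) →
      ∫ ω, |supBM W ω - sSup {x : ℝ | ∃ k : Fin n, x = W (t k) ω}| ∂P
        ≥ c₂ * (n : ℝ) ^ (-(1 / 2) : ℝ) := by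
  have hc : 0 < (gaussianReal 0 1).real (Set.Iic (-2)) * gaussianPDFReal 0 1 1 :=
    mul_pos (gaussianReal_real_Iic_pos one_ne_zero _) (gaussianPDFReal_pos _ _ _ one_ne_zero)
  refine ⟨((gaussianReal 0 1).real (Set.Iic (-2)) * gaussianPDFReal 0 1 1) ^ 2 / 8,
    by positivity, fun n hn t ht => ?_⟩
  refine le_trans (le_of_eq ?_)
    (hW.mul_le_integral_abs_supBM_sub hn fun k => ⟨(ht k).1.le, (ht k).2⟩)
  have hn' : (0 : ℝ) < n := by exact_mod_cast hn
  have h4 : √(4 : ℝ) = 2 := by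
    rw [show (4 : ℝ) = 2 ^ 2 by norm_num]
    exact Real.sqrt_sq zero_le_two
  have hs : √(1 / (4 * n : ℝ)) = (n : ℝ) ^ (-(1 / 2) : ℝ) / 2 := by
    rw [Real.rpow_neg hn'.le, ← Real.sqrt_eq_rpow, Real.sqrt_div zero_le_one,
      Real.sqrt_mul zero_le_four, h4, Real.sqrt_one]
    field_simp
  rw [hs]
  field_simp
  ring
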